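/- Let A be an abelian category, D = D^b(A) its bounded derived category, and let P be a slicing of D compatible with the standard t-structure, i.e. for every integer n and every φ ∈ (n, n+1], every object of P(φ) is isomorphic to M[n] for some object M of A. Assume that every nonzero object of A, viewed as a complex concentrated in degree 0, admits a Harder–Narasimhan filtration with respect to P. Then every nonzero object of D admits a Harder–Narasimhan filtration with respect to P. -/

import Mathlib

open CategoryTheory CategoryTheory.Limits CategoryTheory.Pretriangulated

universe v u

variable (D : Type u) [Category.{v} D] [HasZeroObject D] [HasShift D ℤ] [Preadditive D]
  [∀ n : ℤ, (shiftFunctor D n).Additive] [Pretriangulated D]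

/-- A slicing `P` of a triangulated category `D`: for every real number `φ`, a full additive
subcategory `P φ` (given by a predicate on objects), closed under isomorphisms, such that
(i) `P (φ + 1) = P φ ⟦1⟧` and (ii) `Hom(A₁, A₂) = 0` whenever `A₁ ∈ P φ₁`, `A₂ ∈ P φ₂` and
`φ₁ > φ₂`. -/
structure Slicing where
  /-- the objects of the slice with phase `φ` -/
  P : ℝ → D → Prop
  mem_of_iso : ∀ {φ : ℝ} {X Y : D}, (X ≅ Y) → P φ X → P φ Y
  zero_mem : ∀ (φ : ℝ) (X : D), IsZero X → P φ X
  sum_mem : ∀ (φ : ℝ) (X Y : D), P φ X → P φ Y → P φ (X ⊞ Y)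
  shift_mem : ∀ (φ : ℝ) (X : D), P φ X → P (φ + 1) (X⟦(1 : ℤ)⟧)
  shift_mem' : ∀ (φ : ℝ) (X : D), P (φ + 1) (X⟦(1 : ℤ)⟧) → P φ X
  hom_zero : ∀ {φ₁ φ₂ : ℝ}, φ₂ < φ₁ → ∀ {A₁ A₂ : D}, P φ₁ A₁ → P φ₂ A₂ →
    ∀ f : A₁ ⟶ A₂, f = 0

variable {D}

/-- A Harder–Narasimhan filtration of a (necessarily nonzero) object `X` with respect to a
slicing `S`: a finite collection of distinguished triangles
`F (j+1) → F j → A j →⁺ (F (j+1))⟦1⟧` for `0 ≤ j ≤ n`, with `F 0 = X`, `F (n+1) = 0`, where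
each `A j` is a nonzero object of `S.P (phase j)` and
`phase n > phase (n-1) > ⋯ > phase 0`.
(The semistable HN-factors are `A n, …, A 0`; `φ₊(X) = phase n` and `φ₋(X) = phase 0`.) -/
structure HNFiltration (S : Slicing D) (X : D) where
  /-- the number of steps: there are `n + 1` HN-factors `A 0, …, A n` -/
  n : ℕ
  /-- the filtration objects -/
  F : ℕ → D
  /-- the semistable factors -/
  A : ℕ → D
  /-- the phases of the factors -/
  phase : ℕ → ℝ
  f : ∀ j : ℕ, F (j + 1) ⟶ F j
  g : ∀ j : ℕ, F j ⟶ A j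
  h : ∀ j : ℕ, A j ⟶ (F (j + 1))⟦(1 : ℤ)⟧
  F_zero : F 0 = X
  isZero_top : IsZero (F (n + 1))
  mem : ∀ j ≤ n, S.P (phase j) (A j)
  nonzero : ∀ j ≤ n, ¬ IsZero (A j)
  dist : ∀ j ≤ n, (Triangle.mk (f j) (g j) (h j) ∈ distTriang D)
  phase_lt : ∀ j : ℕ, j + 1 ≤ n → phase j < phase (j + 1)

/-!
STATEMENT 6 (existence of Harder–Narasimhan filtrations):
Let `A` be an abelian category, `D = D^b(A)` its bounded derived category (realised here as
the objects of the derived category of `A` with bounded cohomology), and `P` a slicing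
compatible with the standard t-structure: for every `n : ℤ` and `φ ∈ (n, n+1]`, every object
of `P φ` is isomorphic to `M[n]` for some `M` in `A`. If every nonzero object of `A`, viewed
as a complex concentrated in degree `0`, admits a Harder–Narasimhan filtration, then every
nonzero object of `D^b(A)` admits a Harder–Narasimhan filtration.
-/

/-- `X` has a (possibly empty) HN filtration with all phases in `(c, d]`. -/
inductive HNBetween (S : Slicing D) (d : ℝ) : ℝ → D → Prop
  | zero (c : ℝ) (X : D) (hX : IsZero X) : HNBetween S d c X
  | step (c φ : ℝ) (F X Q : D) (f : F ⟶ X) (g : X ⟶ Q) (h : Q ⟶ F⟦(1 : ℤ)⟧)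
      (dist : Triangle.mk f g h ∈ distTriang D) (hc : c < φ) (hd : φ ≤ d)
      (mem : S.P φ Q) (nz : ¬ IsZero Q) (hF : HNBetween S d φ F) : HNBetween S d c X

namespace HNBetween

lemma mono {S : Slicing D} {d c : ℝ} {X : D} (h : HNBetween S d c X) :
    ∀ {d' c' : ℝ}, d ≤ d' → c' ≤ c → HNBetween S d' c' X := by
  induction h with
  | zero c X hX => intro d' c' _ _; exact .zero _ _ hX
  | step c φ F X Q f g h dist hc hd mem nz hF ih =>
    intro d' c' h1 h2
    exact .step c' φ F X Q f g h dist (by linarith) (by linarith) mem nz (ih h1 le_rfl)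

lemma of_iso {S : Slicing D} {d c : ℝ} {X Y : D} (h : HNBetween S d c X) (e : X ≅ Y) :
    HNBetween S d c Y := by
  cases h with
  | zero _ _ hX => exact .zero _ _ (hX.of_iso e.symm)
  | step _ φ F _ Q f g h dist hc hd mem nz hF =>
    refine .step c φ F Y Q (f ≫ e.hom) (e.inv ≫ g) h ?_ hc hd mem nz hF
    exact isomorphic_distinguished _ dist _
      (Triangle.isoMk _ _ (Iso.refl _) e.symm (Iso.refl _) 
        (by change (f ≫ e.hom) ≫ e.inv = 𝟙 F ≫ f; simp)
        (by change (e.inv ≫ g) ≫ 𝟙 Q = e.inv ≫ g; simp)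
        (by change h ≫ (shiftFunctor D (1 : ℤ)).map (𝟙 F) = 𝟙 Q ≫ h; simp))

/-- concatenation -/
lemma concat [IsTriangulated D] {S : Slicing D} {e d c : ℝ} {Y : D} (hY : HNBetween S d c Y)
    (hcd : c ≤ d) (hde : d ≤ e) :
    ∀ {F X : D} (f : F ⟶ X) (g : X ⟶ Y) (h : Y ⟶ F⟦(1 : ℤ)⟧)
      (_ : Triangle.mk f g h ∈ distTriang D) (_ : HNBetween S e d F), HNBetween S e c X := by
  induction hY with
  | zero c Y hY =>
    intro F X f g h dist hF
    have : IsIso f := (Triangle.isZero₃_iff_isIso₁ _ dist).1 hY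
    exact (hF.of_iso (asIso f)).mono le_rfl hcd
  | step c φ Y' Y Q f' g' h' dist' hc hd mem nz hY' ih =>
    intro F X f g h dist hF
    obtain ⟨X', i, δ, hX'⟩ := distinguished_cocone_triangle₁ (g ≫ g')
    have o := Triangulated.someOctahedron' rfl dist dist' hX'
    exact .step c φ X' X Q i (g ≫ g') δ hX' hc (hd.trans hde) mem nz
      (ih hd _ _ _ o.mem hF)

end HNBetween

lemma Slicing.shift_nat (S : Slicing D) (n : ℕ) {φ : ℝ} {X : D} (h : S.P φ X) :
    S.P (φ + n) (X⟦(n : ℤ)⟧) := by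
  induction n with
  | zero => simpa using S.mem_of_iso ((shiftFunctorZero D ℤ).symm.app X) h
  | succ n ih =>
    have := S.mem_of_iso ((shiftFunctorAdd' D (n : ℤ) 1 ((n + 1 : ℕ) : ℤ) (by simp)).symm.app X)
      (S.shift_mem _ _ ih)
    push_cast at this ⊢
    rwa [← add_assoc]

lemma Slicing.shift_nat' (S : Slicing D) (n : ℕ) : ∀ {φ : ℝ} {X : D},
    S.P (φ + n) (X⟦(n : ℤ)⟧) → S.P φ X := by
  induction n with
  | zero =>
    intro φ X h
    exact S.mem_of_iso ((shiftFunctorZero D ℤ).app X) (by simpa using h)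
  | succ n ih =>
    intro φ X h
    apply ih
    apply S.shift_mem'
    have := S.mem_of_iso ((shiftFunctorAdd' D (n : ℤ) 1 ((n + 1 : ℕ) : ℤ) (by simp)).app X) h
    push_cast at this
    rwa [← add_assoc] at this

lemma Slicing.shift_int (S : Slicing D) (n : ℤ) {φ : ℝ} {X : D} (h : S.P φ X) :
    S.P (φ + n) (X⟦n⟧) := by
  obtain ⟨m, rfl | rfl⟩ := n.eq_nat_or_neg
  · simpa using S.shift_nat m h
  · apply S.shift_nat' m
    have := S.mem_of_iso ((shiftFunctorCompIsoId D (-(m : ℤ)) m (by simp)).symm.app X) h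
    simpa using this

lemma isZero_shift {X : D} (n : ℤ) (h : IsZero X) : IsZero (X⟦n⟧) :=
  (shiftFunctor D n).map_isZero h

lemma isZero_of_shift {X : D} (n : ℤ) (h : IsZero (X⟦n⟧)) : IsZero X :=
  (isZero_shift (-n) h).of_iso ((shiftFunctorCompIsoId D n (-n) (by simp)).symm.app X)

namespace HNBetween

lemma shift {S : Slicing D} {d c : ℝ} {X : D} (hX : HNBetween S d c X) (n : ℤ) :
    HNBetween S (d + n) (c + n) (X⟦n⟧) := by
  induction hX with
  | zero c X hX => exact .zero _ _ (isZero_shift n hX)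
  | step c φ F X Q f g h dist hc hd mem nz hF ih =>
    exact .step _ (φ + n) (F⟦n⟧) (X⟦n⟧) (Q⟦n⟧) _ _ _ (Triangle.shift_distinguished _ dist n)
      (by linarith) (by linarith) (S.shift_int n mem) (fun h => nz (isZero_of_shift n h)) ih

lemma hom_eq_zero {S : Slicing D} {d c : ℝ} {X : D} (hX : HNBetween S d c X) :
    ∀ {ψ : ℝ} {B : D}, S.P ψ B → ψ ≤ c → ∀ a : X ⟶ B, a = 0 := by
  induction hX with
  | zero c X hX => intro ψ B _ _ a; exact hX.eq_of_src _ _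
  | step c φ F X Q f g h dist hc hd mem nz hF ih =>
    intro ψ B hB hψ a
    obtain ⟨b, rfl⟩ := Triangle.yoneda_exact₂ _ dist a (ih hB (by linarith) _)
    have : b = 0 := S.hom_zero (by linarith : ψ < φ) mem hB b
    rw [this]
    exact comp_zero

/-- lower bound on the phases -/
lemma lower {S : Slicing D} {d c c' : ℝ} {X : D} (hX : HNBetween S d c X)
    (H : ∀ {ψ : ℝ} {B : D}, S.P ψ B → ψ ≤ c' → ∀ a : X ⟶ B, a = 0) : HNBetween S d c' X := by
  cases hX with
  | zero _ _ hX => exact .zero _ _ hX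
  | step _ φ F X Q f g h dist hc hd mem nz hF =>
    refine .step _ φ F X Q f g h dist ?_ hd mem nz hF
    by_contra hφ
    have hg : g = 0 := H mem (not_lt.1 hφ) g
    obtain ⟨r, hr⟩ := Triangle.yoneda_exact₃ _ dist (𝟙 Q) (by rw [hg]; exact zero_comp)
    have : r = 0 := (hF.shift 1).hom_eq_zero mem (by push_cast; linarith) r
    apply nz
    rw [IsZero.iff_id_eq_zero]
    rw [this] at hr
    exact hr.trans comp_zero

/-- upper bound on the phases -/
lemma upper {S : Slicing D} {d c d' : ℝ} {X : D} (hX : HNBetween S d c X) :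
    (∀ {ψ : ℝ} {B : D}, S.P ψ B → d' < ψ → c < ψ → ∀ a : B ⟶ X, a = 0) →
    HNBetween S d' c X := by
  induction hX with
  | zero c X hX => intro _; exact .zero _ _ hX
  | step c φ F X Q f g h dist hc hd mem nz hF ih =>
    intro H
    have hF' : HNBetween S d' φ F := by
      apply ih
      intro ψ B hB h1 h2 a
      have h0 : a ≫ f = 0 := H hB h1 (by linarith) _
      obtain ⟨b, hb⟩ := Triangle.coyoneda_exact₁ _ dist (a⟦(1 : ℤ)⟧')
        (by
          change a⟦(1 : ℤ)⟧' ≫ f⟦(1 : ℤ)⟧' = 0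
          rw [← Functor.map_comp, h0, Functor.map_zero])
      have hb0 : b = 0 := S.hom_zero (by linarith : φ < ψ + 1) (S.shift_mem _ _ hB) mem b
      apply (shiftFunctor D (1 : ℤ)).map_injective
      rw [hb0] at hb
      exact (hb.trans zero_comp).trans (Functor.map_zero _ _ _).symm
    refine .step _ φ F X Q f g h dist hc ?_ mem nz hF'
    by_contra hφ
    push Not at hφ
    cases hF' with
    | zero _ _ hF0 =>
      have : IsIso g := (Triangle.isZero₁_iff_isIso₂ _ dist).1 hF0
      apply nz
      rw [IsZero.iff_id_eq_zero]
      have := H mem hφ hc (inv g)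
      rw [← IsIso.inv_hom_id g, this, zero_comp]
    | step _ φ' _ _ _ _ _ _ _ h1 h2 => linarith

lemma toFiltration {S : Slicing D} {d c : ℝ} {X : D} (hX : HNBetween S d c X) :
    ¬ IsZero X → ∃ H : HNFiltration S X, c < H.phase 0 := by
  induction hX with
  | zero c X hX => intro h; exact absurd hX h
  | step c φ F X Q f g h dist hc hd mem nz hF ih =>
    intro _
    by_cases hF0 : IsZero F
    · refine ⟨⟨0, fun j => Nat.casesOn j X (fun _ => F), fun _ => Q, fun _ => φ,
        fun j => Nat.casesOn j f (fun _ => 𝟙 F), fun j => Nat.casesOn j g (fun _ => 0),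
        fun j => Nat.casesOn j h (fun _ => 0), rfl, hF0, fun _ _ => mem, fun _ _ => nz, ?_, ?_⟩, hc⟩
      · intro j hj
        obtain rfl : j = 0 := by omega
        exact dist
      · intro j hj; omega
    · obtain ⟨⟨n, F', A', ph, f', g', h', hF', ht, hm, hn, hdist, hlt⟩, hph⟩ := ih hF0
      subst hF'
      refine ⟨⟨n + 1, fun j => Nat.casesOn j X F', fun j => Nat.casesOn j Q A',
        fun j => Nat.casesOn j φ ph, fun j => Nat.casesOn j f f', fun j => Nat.casesOn j g g',
        fun j => Nat.casesOn j h h', rfl, ht, ?_, ?_, ?_, ?_⟩, hc⟩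
      · rintro (_ | j) hj
        · exact mem
        · exact hm j (by omega)
      · rintro (_ | j) hj
        · exact nz
        · exact hn j (by omega)
      · rintro (_ | j) hj
        · exact dist
        · exact hdist j (by omega)
      · rintro (_ | j) hj
        · exact hph
        · exact hlt j (by omega)

lemma ofFiltration {S : Slicing D} {X : D} (H : HNFiltration S X) :
    HNBetween S (H.phase H.n) (H.phase 0 - 1) X := by
  have hle : ∀ k j, j + k = H.n → H.phase j ≤ H.phase H.n := by
    intro k
    induction k with
    | zero => intro j hj; rw [← hj]; rfl
    | succ k ih =>
      intro j hj
      exact (H.phase_lt j (by omega)).le.trans (ih (j + 1) (by omega))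
  have key : ∀ k j, j + k = H.n + 1 → ∀ c, (j ≤ H.n → c < H.phase j) →
      HNBetween S (H.phase H.n) c (H.F j) := by
    intro k
    induction k with
    | zero => intro j hj c _; obtain rfl : j = H.n + 1 := by omega
              exact .zero _ _ H.isZero_top
    | succ k ih =>
      intro j hj c hc
      exact .step c (H.phase j) _ _ _ _ _ _ (H.dist j (by omega)) (hc (by omega))
        (hle k j (by omega)) (H.mem j (by omega)) (H.nonzero j (by omega))
        (ih (j + 1) (by omega) _ (fun h => H.phase_lt j h))
  have := key (H.n + 1) 0 (by omega) (H.phase 0 - 1) (fun _ => by linarith)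
  rwa [H.F_zero] at this

end HNBetween

theorem statement6
    {A : Type u} [Category.{v} A] [Abelian A] [HasDerivedCategory A]
    (S : Slicing (DerivedCategory A))
    (hcompat : ∀ (n : ℤ) (φ : ℝ), (n : ℝ) < φ → φ ≤ (n : ℝ) + 1 →
      ∀ Z : DerivedCategory A, S.P φ Z →
        ∃ M : A, Nonempty (Z ≅ ((DerivedCategory.singleFunctor A 0).obj M)⟦n⟧))
    (hheart : ∀ M : A, ¬ IsZero M →
      Nonempty (HNFiltration S ((DerivedCategory.singleFunctor A 0).obj M))) :
    ∀ X : DerivedCategory A, ¬ IsZero X →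
      (∃ a b : ℤ, ∀ i : ℤ, (i < a ∨ b < i) →
        IsZero ((DerivedCategory.homologyFunctor A i).obj X)) →
      Nonempty (HNFiltration S X) := by
  classical
  let t := DerivedCategory.TStructure.t (C := A)
  have hGE : ∀ {ψ : ℝ} {B : DerivedCategory A}, S.P ψ B → ψ ≤ 0 → t.IsGE B 1 := by
    intro ψ B hB hψ
    obtain ⟨N, ⟨e⟩⟩ := hcompat (⌈ψ⌉ - 1) ψ
      (by push_cast; linarith [Int.ceil_lt_add_one ψ]) (by push_cast; linarith [Int.le_ceil ψ]) B hB
    have hc : ⌈ψ⌉ ≤ 0 := Int.ceil_le.2 (by simpa using hψ)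
    have h0 : t.IsGE ((DerivedCategory.singleFunctor A 0).obj N) 0 :=
      inferInstanceAs (DerivedCategory.IsGE _ 0)
    have h1 := t.isGE_shift ((DerivedCategory.singleFunctor A 0).obj N) 0 (⌈ψ⌉ - 1) (1 - ⌈ψ⌉)
    have h2 := t.isGE_of_iso e.symm (1 - ⌈ψ⌉)
    exact t.isGE_of_ge B 1 (1 - ⌈ψ⌉)
  have hLE : ∀ {ψ : ℝ} {B : DerivedCategory A}, S.P ψ B → 1 < ψ → t.IsLE B (-1) := by
    intro ψ B hB hψ
    obtain ⟨N, ⟨e⟩⟩ := hcompat (⌈ψ⌉ - 1) ψ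
      (by push_cast; linarith [Int.ceil_lt_add_one ψ]) (by push_cast; linarith [Int.le_ceil ψ]) B hB
    have hc : 1 < ⌈ψ⌉ := Int.lt_ceil.2 (by simpa using hψ)
    have h0 : t.IsLE ((DerivedCategory.singleFunctor A 0).obj N) 0 :=
      inferInstanceAs (DerivedCategory.IsLE _ 0)
    have h1 := t.isLE_shift ((DerivedCategory.singleFunctor A 0).obj N) 0 (⌈ψ⌉ - 1) (1 - ⌈ψ⌉)
    have h2 := t.isLE_of_iso e.symm (1 - ⌈ψ⌉)
    exact t.isLE_of_le B (1 - ⌈ψ⌉) (-1)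
  have heart : ∀ M : A, HNBetween S 1 0 ((DerivedCategory.singleFunctor A 0).obj M) := by
    intro M
    by_cases hM : IsZero M
    · exact .zero _ _ ((DerivedCategory.singleFunctor A 0).map_isZero hM)
    obtain ⟨H⟩ := hheart M hM
    have hM0 : t.IsGE ((DerivedCategory.singleFunctor A 0).obj M) 0 :=
      inferInstanceAs (DerivedCategory.IsGE _ 0)
    have hM1 : t.IsLE ((DerivedCategory.singleFunctor A 0).obj M) 0 :=
      inferInstanceAs (DerivedCategory.IsLE _ 0)
    refine ((HNBetween.ofFiltration H).lower (c' := 0) ?_).upper ?_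
    · intro ψ B hB hψ a
      exact t.zero_of_isLE_of_isGE a 0 1 (by omega) hM1 (hGE hB hψ)
    · intro ψ B hB hψ _ a
      exact t.zero_of_isLE_of_isGE a (-1) 0 (by omega) (hLE hB hψ) hM0
  have main : ∀ (a : ℤ) (k : ℕ) (X : DerivedCategory A), t.IsGE X a → t.IsLE X (a - 1 + k) →
      HNBetween S (-a + 1) (-(a - 1 + k)) X := by
    intro a k
    induction k with
    | zero =>
      intro X h1 h2
      simp only [Nat.cast_zero, add_zero] at h2
      exact .zero _ _ (t.isZero X (a - 1) a)
    | succ k ih =>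
      intro X h1 h2
      have h2' : t.IsLE X (a + k) := by
        have e : a - 1 + ((k + 1 : ℕ) : ℤ) = a + k := by push_cast; ring
        rwa [e] at h2
      have hd := t.triangleLTGE_distinguished (a + k) X
      have hF := ih ((t.truncLT (a + k)).obj X) inferInstance
        (t.isLE_truncLT_obj X (a + k) (a - 1 + k))
      have hY1 : DerivedCategory.IsGE ((t.truncGE (a + k)).obj X) (a + k) :=
        inferInstanceAs (t.IsGE _ _)
      have hY2 : DerivedCategory.IsLE ((t.truncGE (a + k)).obj X) (a + k) :=
        inferInstanceAs (t.IsLE _ _)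
      obtain ⟨M, ⟨e⟩⟩ := DerivedCategory.exists_iso_singleFunctor_obj_of_isGE_of_isLE
        ((t.truncGE (a + k)).obj X) (a + k)
      let e' := ((DerivedCategory.singleFunctors A).shiftIso (-(a + k)) (a + k) 0 (by ring)).app M
      have hY : HNBetween S (1 + ((-(a + k) : ℤ) : ℝ)) (0 + ((-(a + k) : ℤ) : ℝ))
          ((t.truncGE (a + k)).obj X) := ((heart M).shift (-(a + k))).of_iso (e' ≪≫ e.symm)
      have := HNBetween.concat (e := -a + 1) hY (by linarith)
        (by push_cast; have : (0 : ℝ) ≤ k := k.cast_nonneg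
            linarith) _ _ _ hd
        (hF.mono le_rfl (by push_cast; linarith))
      exact this.mono le_rfl (by push_cast; linarith)
  rintro X hX ⟨a, b, hab⟩
  have h1 : t.IsGE X a := (DerivedCategory.isGE_iff X a).2 fun i hi => hab i (Or.inl hi)
  have h2 : t.IsLE X b := (DerivedCategory.isLE_iff X b).2 fun i hi => hab i (Or.inr hi)
  have h3 : t.IsLE X (a - 1 + ((b - a + 1).toNat : ℤ)) :=
    t.isLE_of_le X b _ (by have := Int.self_le_toNat (b - a + 1); omega)
  obtain ⟨H, _⟩ := (main a _ X h1 h3).toFiltration hX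
  exact ⟨H⟩
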